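/- arXiv:2602.03330 — 2 statements merged into one kernel-verified Lean document; each statement's English description precedes it below -/
import Mathlib

section
/- Baseline-free difference identity for the cost functional. Let A', A'' be sources with baselines ξ^{A'}, ξ^{A''} satisfying the orthogonality condition (∫ ⟨A', g⟩⟨ξ^{A'}, h⟩ dμ = 0 and ∫ ⟨A'', g⟩⟨ξ^{A''}, h⟩ dμ = 0 for all g, h ∈ E) and the equal second-order structure condition (∫ ⟨ξ^{A'}, g⟩⟨ξ^{A'}, h⟩ dμ = ∫ ⟨ξ^{A''}, g⟩⟨ξ^{A''}, h⟩ dμ for all g, h ∈ E). Then for every continuous linear map T : H → H_o, R_{A''}(T) − R_{A'}(T) = h_{A''}(T) − h_{A'}(T), where h_A(T) := ∫ ‖S₁(A ω) − T(S₂(A ω))‖²_{H_o} dμ is the cost with baseline omitted. -/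
open MeasureTheory RealInnerProductSpace

theorem aux_hilbertBasis_countable {ι F : Type*} [NormedAddCommGroup F] [InnerProductSpace ℝ F]
    [SecondCountableTopology F] (b : HilbertBasis ι ℝ F) : Countable ι := by
  have hd : Pairwise (Function.onFun Disjoint fun i => Metric.ball (b i) (1 / 2 : ℝ)) := by
    intro i j hij
    apply Metric.ball_disjoint_ball
    have h1 : ‖b i - b j‖ ^ 2 = 2 := by
      rw [norm_sub_sq_real, b.orthonormal.2 hij, b.orthonormal.1 i, b.orthonormal.1 j]
      norm_num
    rw [dist_eq_norm]
    nlinarith [norm_nonneg (b i - b j)]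
  exact hd.countable_of_isOpen_disjoint (fun i => Metric.isOpen_ball)
    (fun i => ⟨b i, Metric.mem_ball_self (by norm_num)⟩)

theorem aux_hasSum {Ω E F ι : Type*} [MeasurableSpace Ω] (μ : Measure Ω)
    [NormedAddCommGroup E] [InnerProductSpace ℝ E] [CompleteSpace E]
    [NormedAddCommGroup F] [InnerProductSpace ℝ F] [CompleteSpace F]
    [SecondCountableTopology F] (b : HilbertBasis ι ℝ F)
    (L : E →L[ℝ] F) (f g : Ω → E) (hf : StronglyMeasurable f) (hg : StronglyMeasurable g)
    (hfi : Integrable (fun ω => ‖L (f ω)‖ ^ 2) μ) (hgi : Integrable (fun ω => ‖L (g ω)‖ ^ 2) μ) :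
    HasSum (fun i => ∫ ω, ⟪f ω, L.adjoint (b i)⟫ * ⟪g ω, L.adjoint (b i)⟫ ∂μ)
      (∫ ω, ⟪L (f ω), L (g ω)⟫ ∂μ) := by
  have := aux_hilbertBasis_countable b
  have hs : ∀ x y : F, HasSum (fun i => ⟪x, b i⟫ * ⟪y, b i⟫) ⟪x, y⟫ := by
    intro x y
    simpa only [real_inner_comm y] using b.hasSum_inner_mul_inner x y
  have hb : ∀ x y : F, HasSum (fun i => ⟪x, b i⟫ * ⟪x, b i⟫ + ⟪y, b i⟫ * ⟪y, b i⟫)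
      (‖x‖ ^ 2 + ‖y‖ ^ 2) := by
    intro x y
    simpa only [real_inner_self_eq_norm_sq] using (hs x x).add (hs y y)
  simp only [ContinuousLinearMap.adjoint_inner_right]
  have hLf : StronglyMeasurable fun ω => L (f ω) := L.continuous.comp_stronglyMeasurable hf
  have hLg : StronglyMeasurable fun ω => L (g ω) := L.continuous.comp_stronglyMeasurable hg
  refine hasSum_integral_of_dominated_convergence
    (fun i ω => ⟪L (f ω), b i⟫ * ⟪L (f ω), b i⟫ + ⟪L (g ω), b i⟫ * ⟪L (g ω), b i⟫) ?_ ?_ ?_ ?_ ?_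
  · intro i
    exact ((hLf.inner stronglyMeasurable_const).mul
      (hLg.inner stronglyMeasurable_const)).aestronglyMeasurable
  · intro i
    refine Filter.Eventually.of_forall fun ω => ?_
    rw [Real.norm_eq_abs, abs_le]
    constructor <;> nlinarith [sq_nonneg (⟪L (f ω), b i⟫ - ⟪L (g ω), b i⟫),
      sq_nonneg (⟪L (f ω), b i⟫ + ⟪L (g ω), b i⟫), sq_nonneg ⟪L (f ω), b i⟫,
      sq_nonneg ⟪L (g ω), b i⟫]
  · exact Filter.Eventually.of_forall fun ω => (hb _ _).summable
  · simp only [(hb _ _).tsum_eq]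
    exact hfi.add hgi
  · exact Filter.Eventually.of_forall fun ω => hs _ _

theorem aux_sq {Ω E F : Type*} [MeasurableSpace Ω] (μ : Measure Ω)
    [NormedAddCommGroup E] [InnerProductSpace ℝ E]
    [NormedAddCommGroup F] [InnerProductSpace ℝ F]
    (L : E →L[ℝ] F) (f : Ω → E) (hf : StronglyMeasurable f)
    (hfi : Integrable (fun ω => ‖f ω‖ ^ 2) μ) : MemLp (fun ω => L (f ω)) 2 μ :=
  L.comp_memLp' ((memLp_two_iff_integrable_sq_norm hf.aestronglyMeasurable).2 hfi)

theorem aux_expand {Ω E F ι : Type*} [MeasurableSpace Ω] (μ : Measure Ω)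
    [NormedAddCommGroup E] [InnerProductSpace ℝ E] [CompleteSpace E]
    [NormedAddCommGroup F] [InnerProductSpace ℝ F] [CompleteSpace F]
    [SecondCountableTopology F] (b : HilbertBasis ι ℝ F)
    (L : E →L[ℝ] F) (f g : Ω → E) (hf : StronglyMeasurable f) (hg : StronglyMeasurable g)
    (hfi : Integrable (fun ω => ‖f ω‖ ^ 2) μ) (hgi : Integrable (fun ω => ‖g ω‖ ^ 2) μ)
    (ho : ∀ u v : E, (∫ ω, ⟪f ω, u⟫ * ⟪g ω, v⟫ ∂μ) = 0) :
    ∫ ω, ‖L (f ω + g ω)‖ ^ 2 ∂μ = (∫ ω, ‖L (f ω)‖ ^ 2 ∂μ) +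
      ∑' i, ∫ ω, ⟪g ω, L.adjoint (b i)⟫ * ⟪g ω, L.adjoint (b i)⟫ ∂μ := by
  have mf := aux_sq μ L f hf hfi
  have mg := aux_sq μ L g hg hgi
  have If := (memLp_two_iff_integrable_sq_norm mf.1).1 mf
  have Ig := (memLp_two_iff_integrable_sq_norm mg.1).1 mg
  have mfg := mf.add mg
  have Ifg := (memLp_two_iff_integrable_sq_norm mfg.1).1 mfg
  have h1 := aux_hasSum μ b L f g hf hg If Ig
  have h2 := aux_hasSum μ b L g g hg hg Ig Ig
  simp only [ho] at h1
  have h0 : ∫ ω, ⟪L (f ω), L (g ω)⟫ ∂μ = 0 := h1.unique hasSum_zero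
  have e : ∀ ω, ‖L (f ω + g ω)‖ ^ 2 = ‖L (f ω)‖ ^ 2 + 2 * ⟪L (f ω), L (g ω)⟫ + ‖L (g ω)‖ ^ 2 := by
    intro ω
    rw [map_add, norm_add_sq_real]
  have Ic : Integrable (fun ω => 2 * ⟪L (f ω), L (g ω)⟫) μ := by
    refine ((Ifg.sub If).sub Ig).congr (Filter.Eventually.of_forall fun ω => ?_)
    simp only [Pi.sub_apply, Pi.add_apply]
    rw [norm_add_sq_real]
    ring
  simp only [e]
  have Is : Integrable (fun ω => ‖L (f ω)‖ ^ 2 + 2 * ⟪L (f ω), L (g ω)⟫) μ := If.add Ic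
  rw [integral_add Is Ig, integral_add If Ic, integral_const_mul, h0, h2.tsum_eq]
  simp only [real_inner_self_eq_norm_sq]
  ring

/-- **Baseline-free difference identity for the cost functional.** If two sources `A'` and
`A''` have baselines `ξ'`, `ξ''` that are orthogonal to their sources and have equal
second-order structure, then the difference of cost functionals equals the difference of
baseline-free costs: `R_{A''}(T) − R_{A'}(T) = h_{A''}(T) − h_{A'}(T)`. -/
theorem baseline_free_difference
    {Ω : Type} [MeasurableSpace Ω] (μ : Measure Ω) [IsFiniteMeasure μ]
    {E Ho H : Type}
    [NormedAddCommGroup E] [InnerProductSpace ℝ E] [CompleteSpace E]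
    [SecondCountableTopology E]
    [NormedAddCommGroup Ho] [InnerProductSpace ℝ Ho] [CompleteSpace Ho]
    [SecondCountableTopology Ho]
    [NormedAddCommGroup H] [InnerProductSpace ℝ H] [CompleteSpace H]
    [SecondCountableTopology H]
    (S₁ : E →L[ℝ] Ho) (S₂ : E →L[ℝ] H) (T : H →L[ℝ] Ho)
    (A' A'' ξ' ξ'' : Ω → E)
    (hA' : StronglyMeasurable A') (hA'' : StronglyMeasurable A'')
    (hξ' : StronglyMeasurable ξ') (hξ'' : StronglyMeasurable ξ'')
    (hA'int : Integrable (fun ω => ‖A' ω‖ ^ 2) μ)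
    (hA''int : Integrable (fun ω => ‖A'' ω‖ ^ 2) μ)
    (hξ'int : Integrable (fun ω => ‖ξ' ω‖ ^ 2) μ)
    (hξ''int : Integrable (fun ω => ‖ξ'' ω‖ ^ 2) μ)
    (horth' : ∀ g h : E, (∫ ω, ⟪A' ω, g⟫ * ⟪ξ' ω, h⟫ ∂μ) = 0)
    (horth'' : ∀ g h : E, (∫ ω, ⟪A'' ω, g⟫ * ⟪ξ'' ω, h⟫ ∂μ) = 0)
    (hsecond : ∀ g h : E,
      (∫ ω, ⟪ξ' ω, g⟫ * ⟪ξ' ω, h⟫ ∂μ) = ∫ ω, ⟪ξ'' ω, g⟫ * ⟪ξ'' ω, h⟫ ∂μ) :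
    (∫ ω, ‖S₁ (A'' ω + ξ'' ω) - T (S₂ (A'' ω + ξ'' ω))‖ ^ 2 ∂μ) -
      (∫ ω, ‖S₁ (A' ω + ξ' ω) - T (S₂ (A' ω + ξ' ω))‖ ^ 2 ∂μ) =
    (∫ ω, ‖S₁ (A'' ω) - T (S₂ (A'' ω))‖ ^ 2 ∂μ) -
      ∫ ω, ‖S₁ (A' ω) - T (S₂ (A' ω))‖ ^ 2 ∂μ := by
  obtain ⟨w, b, -⟩ := exists_hilbertBasis ℝ Ho
  have e : ∀ x, S₁ x - T (S₂ x) = (S₁ - T.comp S₂) x := fun x => rfl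
  simp only [e]
  rw [aux_expand μ b _ A'' ξ'' hA'' hξ'' hA''int hξ''int horth'',
    aux_expand μ b _ A' ξ' hA' hξ' hA'int hξ'int horth']
  simp only [hsecond]
  ring
end

section
/- Worst-case upper bound over the envelope (upper-bound half of the extremal principle). Let A and A' be sources with baselines ξ^A, ξ^{A'} satisfying the orthogonality condition (∫ ⟨A, g⟩⟨ξ^A, h⟩ dμ = 0 and ∫ ⟨A', g⟩⟨ξ^{A'}, h⟩ dμ = 0 for all g, h ∈ E) and the equal second-order structure condition (∫ ⟨ξ^A, g⟩⟨ξ^A, h⟩ dμ = ∫ ⟨ξ^{A'}, g⟩⟨ξ^{A'}, h⟩ dμ for all g, h ∈ E). If q_{A'}(g) ≤ q_A(g) for all g ∈ E (Löwner domination of source covariances), then R_{A'}(T) ≤ R_A(T) for every Hilbert–Schmidt operator T : H → H_o. -/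
open MeasureTheory RealInnerProductSpace


theorem aux_countable {F : Type} [NormedAddCommGroup F] [InnerProductSpace ℝ F]
    [SecondCountableTopology F] {ι : Type} (v : ι → F) (hv : Orthonormal ℝ v) : Countable ι := by
  refine Pairwise.countable_of_isOpen_disjoint (s := fun i => Metric.ball (v i) (1 / 2)) ?_
    (fun i => Metric.isOpen_ball) (fun i => ⟨v i, Metric.mem_ball_self (by norm_num)⟩)
  intro i j hij
  apply Metric.ball_disjoint_ball
  rw [dist_eq_norm]
  have h : ‖v i - v j‖ ^ 2 = 2 := by
    rw [norm_sub_sq_real, hv.1 i, hv.1 j, hv.2 hij]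
    norm_num
  nlinarith [norm_nonneg (v i - v j)]

theorem aux_lintegral {Ω : Type} [MeasurableSpace Ω] (μ : Measure Ω)
    {E F ι : Type} [NormedAddCommGroup E] [InnerProductSpace ℝ E] [CompleteSpace E]
    [NormedAddCommGroup F] [InnerProductSpace ℝ F] [CompleteSpace F] [Countable ι]
    (b : HilbertBasis ι ℝ F) (L : E →L[ℝ] F) (X : Ω → E) (hX : MemLp X 2 μ) :
    ENNReal.ofReal (∫ ω, ‖L (X ω)‖ ^ 2 ∂μ) =
      ∑' i, ENNReal.ofReal (∫ ω, ⟪X ω, L.adjoint (b i)⟫ ^ 2 ∂μ) := by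
  have h1 : MemLp (fun ω => L (X ω)) 2 μ := L.comp_memLp' hX
  have h2 : Integrable (fun ω => ‖L (X ω)‖ ^ 2) μ :=
    (memLp_two_iff_integrable_sq_norm h1.1).1 h1
  have h3 : ∀ i, Integrable (fun ω => ⟪X ω, L.adjoint (b i)⟫ ^ 2) μ :=
    fun i => (hX.inner_const _).integrable_sq
  have h4 : ∀ ω, ENNReal.ofReal (‖L (X ω)‖ ^ 2) =
      ∑' i, ENNReal.ofReal (⟪X ω, L.adjoint (b i)⟫ ^ 2) := by
    intro ω
    have hs : HasSum (fun i => ⟪X ω, L.adjoint (b i)⟫ ^ 2) (‖L (X ω)‖ ^ 2) := by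
      have := b.hasSum_inner_mul_inner (L (X ω)) (L (X ω))
      rw [real_inner_self_eq_norm_sq] at this
      have e : (fun i => ⟪X ω, L.adjoint (b i)⟫ ^ 2) =
          fun i => ⟪L (X ω), b i⟫ * ⟪b i, L (X ω)⟫ := by
        funext i
        rw [ContinuousLinearMap.adjoint_inner_right, real_inner_comm (L (X ω)) (b i), sq]
      rw [e]
      exact this
    rw [← hs.tsum_eq]
    exact ENNReal.ofReal_tsum_of_nonneg (fun i => sq_nonneg _) hs.summable
  rw [ofReal_integral_eq_lintegral_ofReal h2 (.of_forall fun _ => sq_nonneg _)]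
  simp_rw [h4]
  rw [lintegral_tsum (fun i => (h3 i).1.aemeasurable.ennreal_ofReal)]
  refine tsum_congr fun i => ?_
  rw [ofReal_integral_eq_lintegral_ofReal (h3 i) (.of_forall fun _ => sq_nonneg _)]

theorem aux_split {Ω : Type} [MeasurableSpace Ω] (μ : Measure Ω)
    {E : Type} [NormedAddCommGroup E] [InnerProductSpace ℝ E]
    (A ξ : Ω → E) (hA : MemLp A 2 μ) (hξ : MemLp ξ 2 μ) (g : E)
    (h : (∫ ω, ⟪A ω, g⟫ * ⟪ξ ω, g⟫ ∂μ) = 0) :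
    (∫ ω, ⟪A ω + ξ ω, g⟫ ^ 2 ∂μ) = (∫ ω, ⟪A ω, g⟫ ^ 2 ∂μ) + ∫ ω, ⟪ξ ω, g⟫ * ⟪ξ ω, g⟫ ∂μ := by
  have a := hA.inner_const (𝕜 := ℝ) g
  have x := hξ.inner_const (𝕜 := ℝ) g
  have i1 : Integrable (fun ω => ⟪A ω, g⟫ ^ 2) μ := a.integrable_sq
  have i2 : Integrable (fun ω => ⟪A ω, g⟫ * ⟪ξ ω, g⟫) μ := a.integrable_mul x
  have i3 : Integrable (fun ω => ⟪ξ ω, g⟫ * ⟪ξ ω, g⟫) μ := x.integrable_mul x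
  have i4 : Integrable (fun ω => ⟪A ω, g⟫ ^ 2 + 2 * (⟪A ω, g⟫ * ⟪ξ ω, g⟫)) μ :=
    i1.add (i2.const_mul 2)
  have e : ∀ ω, ⟪A ω + ξ ω, g⟫ ^ 2 =
      (⟪A ω, g⟫ ^ 2 + 2 * (⟪A ω, g⟫ * ⟪ξ ω, g⟫)) + ⟪ξ ω, g⟫ * ⟪ξ ω, g⟫ := by
    intro ω
    rw [inner_add_left]
    ring
  simp_rw [e]
  rw [integral_add i4 i3, integral_add i1 (i2.const_mul 2),
    integral_const_mul, h]
  ring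

/-- **Worst-case upper bound over the envelope** (upper-bound half of the extremal
principle). Let `A` and `A'` be sources with baselines `ξA`, `ξA'` that are orthogonal to
their sources and have equal second-order structure. If the source covariance of `A'` is
Löwner-dominated by that of `A`, i.e. `q_{A'}(g) ≤ q_A(g)` for all `g ∈ E`, then
`R_{A'}(T) ≤ R_A(T)` for every Hilbert–Schmidt operator `T : H → H_o`. -/
theorem worst_case_upper_bound
    {Ω : Type} [MeasurableSpace Ω] (μ : Measure Ω) [IsFiniteMeasure μ]
    {E Ho H : Type}
    [NormedAddCommGroup E] [InnerProductSpace ℝ E] [CompleteSpace E]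
    [SecondCountableTopology E]
    [NormedAddCommGroup Ho] [InnerProductSpace ℝ Ho] [CompleteSpace Ho]
    [SecondCountableTopology Ho]
    [NormedAddCommGroup H] [InnerProductSpace ℝ H] [CompleteSpace H]
    [SecondCountableTopology H]
    (S₁ : E →L[ℝ] Ho) (S₂ : E →L[ℝ] H)
    (A A' ξA ξA' : Ω → E)
    (hA : StronglyMeasurable A) (hA' : StronglyMeasurable A')
    (hξA : StronglyMeasurable ξA) (hξA' : StronglyMeasurable ξA')
    (hAint : Integrable (fun ω => ‖A ω‖ ^ 2) μ)
    (hA'int : Integrable (fun ω => ‖A' ω‖ ^ 2) μ)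
    (hξAint : Integrable (fun ω => ‖ξA ω‖ ^ 2) μ)
    (hξA'int : Integrable (fun ω => ‖ξA' ω‖ ^ 2) μ)
    (horthA : ∀ g h : E, (∫ ω, ⟪A ω, g⟫ * ⟪ξA ω, h⟫ ∂μ) = 0)
    (horthA' : ∀ g h : E, (∫ ω, ⟪A' ω, g⟫ * ⟪ξA' ω, h⟫ ∂μ) = 0)
    (hsecond : ∀ g h : E,
      (∫ ω, ⟪ξA ω, g⟫ * ⟪ξA ω, h⟫ ∂μ) = ∫ ω, ⟪ξA' ω, g⟫ * ⟪ξA' ω, h⟫ ∂μ)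
    (hdom : ∀ g : E, (∫ ω, ⟪A' ω, g⟫ ^ 2 ∂μ) ≤ ∫ ω, ⟪A ω, g⟫ ^ 2 ∂μ)
    (T : H →L[ℝ] Ho) (ψ : HilbertBasis ℕ ℝ H)
    (hT : Summable fun l => ‖T (ψ l)‖ ^ 2) :
    (∫ ω, ‖S₁ (A' ω + ξA' ω) - T (S₂ (A' ω + ξA' ω))‖ ^ 2 ∂μ) ≤
      ∫ ω, ‖S₁ (A ω + ξA ω) - T (S₂ (A ω + ξA ω))‖ ^ 2 ∂μ := by
  have mA := (memLp_two_iff_integrable_sq_norm hA.aestronglyMeasurable).2 hAint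
  have mA' := (memLp_two_iff_integrable_sq_norm hA'.aestronglyMeasurable).2 hA'int
  have mξ := (memLp_two_iff_integrable_sq_norm hξA.aestronglyMeasurable).2 hξAint
  have mξ' := (memLp_two_iff_integrable_sq_norm hξA'.aestronglyMeasurable).2 hξA'int
  obtain ⟨w, b, -⟩ := exists_hilbertBasis ℝ Ho
  haveI : Countable w := aux_countable b b.orthonormal
  have k1 := aux_lintegral μ b (S₁ - T.comp S₂) (fun ω => A ω + ξA ω) (mA.add mξ)
  have k2 := aux_lintegral μ b (S₁ - T.comp S₂) (fun ω => A' ω + ξA' ω) (mA'.add mξ')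
  change ENNReal.ofReal (∫ ω, ‖S₁ (A ω + ξA ω) - T (S₂ (A ω + ξA ω))‖ ^ 2 ∂μ) = _ at k1
  change ENNReal.ofReal (∫ ω, ‖S₁ (A' ω + ξA' ω) - T (S₂ (A' ω + ξA' ω))‖ ^ 2 ∂μ) = _ at k2
  rw [← ENNReal.ofReal_le_ofReal_iff (integral_nonneg fun _ => sq_nonneg _), k1, k2]
  refine ENNReal.tsum_le_tsum fun i => ENNReal.ofReal_le_ofReal ?_
  rw [aux_split μ A ξA mA mξ _ (horthA _ _), aux_split μ A' ξA' mA' mξ' _ (horthA' _ _), hsecond]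
  exact add_le_add (hdom _) le_rfl
end
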